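/- Let R be a commutative locally stable ring. Then R is an elementary divisor ring if and only if R is a Bézout ring. -/

import Mathlib

/-- A commutative ring has stable range 1. -/
def HasStableRange1 (R : Type*) [CommRing R] : Prop :=
  ∀ a b : R, Ideal.span {a} ⊔ Ideal.span {b} = ⊤ → ∃ y : R, IsUnit (a + b * y)

/-- An element `a` is stable if `R/aR` has stable range 1. -/
def IsStableElem {R : Type*} [CommRing R] (a : R) : Prop :=
  HasStableRange1 (R ⧸ Ideal.span {a})

/-- A commutative ring is locally stable. -/
def LocallyStable (R : Type*) [CommRing R] : Prop :=
  ∀ a b : R, Ideal.span {a} ⊔ Ideal.span {b} = ⊤ →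
    ∃ y : R, HasStableRange1 (R ⧸ Ideal.span {a + b * y})

/-- A clean ring: every element is the sum of an idempotent and a unit. -/
def IsCleanRing (R : Type*) [CommRing R] : Prop :=
  ∀ a : R, ∃ e u : R, IsIdempotentElem e ∧ IsUnit u ∧ a = e + u

/-- A ring has neat range 1. -/
def NeatRange1 (R : Type*) [CommRing R] : Prop :=
  ∀ a b : R, Ideal.span {a} ⊔ Ideal.span {b} = ⊤ →
    ∃ y : R, IsCleanRing (R ⧸ Ideal.span {a + b * y})

/-- A ring has almost stable range 1: every proper homomorphic image has stable range 1. -/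
def AlmostStableRange1 (R : Type*) [CommRing R] : Prop :=
  ∀ I : Ideal R, I ≠ ⊥ → HasStableRange1 (R ⧸ I)

/-- An elementary divisor ring: every rectangular matrix admits diagonal reduction. -/
def ElementaryDivisorRing (R : Type*) [CommRing R] : Prop :=
  ∀ (m n : ℕ) (A : Matrix (Fin m) (Fin n) R),
    ∃ (P : Matrix (Fin m) (Fin m) R) (Q : Matrix (Fin n) (Fin n) R),
      IsUnit P ∧ IsUnit Q ∧
      (∀ (i : Fin m) (j : Fin n), (i : ℕ) ≠ (j : ℕ) → (P * A * Q) i j = 0) ∧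
      (∀ (i i' : Fin m) (j j' : Fin n), (i : ℕ) = (j : ℕ) → (i' : ℕ) = (j' : ℕ) →
        (i' : ℕ) = (i : ℕ) + 1 → (P * A * Q) i j ∣ (P * A * Q) i' j')

/-- A ring is strongly completable. -/
def StronglyCompletable (R : Type*) [CommRing R] : Prop :=
  ∀ (n : ℕ) (hn : 0 < n) (a : Fin n → R) (d : R),
    (⨆ i, Ideal.span {a i}) = Ideal.span {d} →
    ∃ A : Matrix (Fin n) (Fin n) R, (∀ j, A ⟨0, hn⟩ j = a j) ∧ A.det = d

open Module

/-- A ring has the Hermite factorization property if every pair of elements is a common multiple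
of a unimodular pair. -/
def HasHermiteFactorization (R : Type*) [CommRing R] : Prop :=
  ∀ a b : R, ∃ d a' b' u w : R, a = d * a' ∧ b = d * b' ∧ u * a' + w * b' = 1

lemma HasStableRange1.exists_of_dvd {R : Type*} [CommRing R] {c : R}
    (hc : HasStableRange1 (R ⧸ Ideal.span {c})) {g a b x y z : R} (hg : g ∣ c)
    (h : x * a + y * b + z * g = 1) : ∃ t s r : R, (a + b * t) * s + g * r = 1 := by
  obtain ⟨k, rfl⟩ := hg
  let π := Ideal.Quotient.mk (Ideal.span {g * k})
  have h1 : Ideal.span {π a} ⊔ Ideal.span {π (y * b + z * g)} = ⊤ := by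
    rw [← Ideal.isCoprime_iff_sup_eq, Ideal.isCoprime_span_singleton_iff]
    refine ⟨π x, π 1, ?_⟩
    rw [← map_mul, ← map_mul, ← map_add, ← map_one π]
    congr 1
    linear_combination h
  obtain ⟨t, ht⟩ := hc _ _ h1
  obtain ⟨t, rfl⟩ := Ideal.Quotient.mk_surjective t
  obtain ⟨s, hs⟩ := ht.exists_right_inv
  obtain ⟨s, rfl⟩ := Ideal.Quotient.mk_surjective s
  have h2 : π ((a + (y * b + z * g) * t) * s) = π 1 := by
    simpa [π] using hs
  rw [Ideal.Quotient.eq, Ideal.mem_span_singleton] at h2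
  obtain ⟨r, hr⟩ := h2
  exact ⟨y * t, s, z * t * s - k * r, by linear_combination hr⟩

lemma LocallyStable.exists_stable {R : Type*} [CommRing R] (h : LocallyStable R) {a b x y : R}
    (hab : x * a + y * b = 1) : ∃ w : R, HasStableRange1 (R ⧸ Ideal.span {a + b * w}) := by
  apply h
  rw [← Ideal.isCoprime_iff_sup_eq, Ideal.isCoprime_span_singleton_iff]
  exact ⟨x, y, hab⟩

/-- Locally stable rings have stable range at most two. -/
lemma LocallyStable.stableRange_two {R : Type*} [CommRing R] (h : LocallyStable R)
    {a b c x y z : R} (habc : x * a + y * b + z * c = 1) :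
    ∃ s t u w : R, u * (a + c * s) + w * (b + c * t) = 1 := by
  obtain ⟨v, hv⟩ := h.exists_stable (a := a) (b := y * b + z * c) (x := x) (y := 1)
    (by linear_combination habc)
  obtain ⟨t, s, r, ht⟩ := hv.exists_of_dvd (a := b) (b := c) (x := y - x * v * y)
    (y := z - x * v * z) (z := x) dvd_rfl (by linear_combination habc)
  exact ⟨v * (z - t * y), t, r, s + r * y * v, by linear_combination ht⟩

lemma LocallyStable.hasHermiteFactorization {R : Type*} [CommRing R] (h : LocallyStable R)
    (hR : IsBezout R) : HasHermiteFactorization R := by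
  intro a b
  obtain ⟨a₁, ha⟩ := IsBezout.gcd_dvd_left a b
  obtain ⟨b₁, hb⟩ := IsBezout.gcd_dvd_right a b
  obtain ⟨u, w, huw⟩ := IsBezout.gcd_eq_sum a b
  set d := IsBezout.gcd a b
  obtain ⟨s, t, u', w', h1⟩ := h.stableRange_two (a := a₁) (b := b₁)
    (c := 1 - u * a₁ - w * b₁) (x := u) (y := w) (z := 1) (by ring)
  have hd : d * (1 - u * a₁ - w * b₁) = 0 := by
    linear_combination -huw + u * ha + w * hb
  exact ⟨d, _, _, u', w', by linear_combination ha - s * hd, by linear_combination hb - t * hd, h1⟩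

/-- A lower triangular two by two matrix with comaximal entries represents `1`. -/
lemma LocallyStable.exists_triangular_eq_one {R : Type*} [CommRing R] (h : LocallyStable R)
    (hH : HasHermiteFactorization R) {d a b x y z : R} (hu : x * d + y * a + z * b = 1) :
    ∃ p₀ p₁ q₀ q₁ : R, p₀ * d * q₀ + p₁ * (a * q₀ + b * q₁) = 1 := by
  obtain ⟨v, hv⟩ := h.exists_stable (a := a) (b := x * d + z * b) (x := y) (y := 1)
    (by linear_combination hu)
  obtain ⟨g, a', b', u, w, ha, hb, huw⟩ := hH (a + (x * d + z * b) * v) b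
  have hg : x * (1 - y * v) * d + (y * a' + z * (1 - y * v) * b') * g = 1 := by
    linear_combination hu - y * ha - z * (1 - y * v) * hb
  obtain ⟨t, s, r, ht⟩ := hv.exists_of_dvd (a := d * u) (b := -(d * b'))
    (x := x * (1 - y * v) * a') (y := -(x * (1 - y * v) * w))
    (z := y * a' + z * (1 - y * v) * b') ⟨a', ha⟩
    (by linear_combination hg + x * (1 - y * v) * d * huw)
  refine ⟨s + r * x * v, r, u - b' * t, w + a' * t + z * v * (u - b' * t), ?_⟩
  linear_combination ht + r * (u - b' * t) * ha + r * (w + a' * t) * hb + r * g * huw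

/-- The automorphism of a free module acting on the plane spanned by two basis vectors through a
matrix of determinant one and fixing the other basis vectors. -/
noncomputable def Module.Basis.planeEquiv {R M ι : Type*} [CommRing R] [AddCommGroup M] [Module R M]
    (b : Basis ι R M) {i j : ι} (hij : i ≠ j) (p q r s : R) (hdet : p * s - q * r = 1) :
    M ≃ₗ[R] M :=
  let T (p q r s : R) : M →ₗ[R] M := LinearMap.id +
    ((p - 1) • b.coord i + q • b.coord j).smulRight (b i) +
    (r • b.coord i + (s - 1) • b.coord j).smulRight (b j)
  have key (p q r s : R) (hdet : p * s - q * r = 1) :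
      (T p q r s).comp (T s (-q) (-r) p) = LinearMap.id := by
    ext x
    simp [T, hij, hij.symm]
    match_scalars
    · rfl
    · linear_combination b.repr x i * hdet
    · linear_combination b.repr x j * hdet
  LinearEquiv.ofLinearMap (T p q r s) (T s (-q) (-r) p) (key p q r s hdet)
    (by simpa using key s (-q) (-r) p (by linear_combination hdet))

lemma HasHermiteFactorization.exists_basis {R M ι : Type*} [CommRing R] [AddCommGroup M]
    [Module R M] (hH : HasHermiteFactorization R) [Finite ι] (b : Basis ι R M) (φ : M →ₗ[R] R)
    (i : ι) : ∃ b' : Basis ι R M, ∀ j, j ≠ i → φ (b' j) = 0 := by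
  classical
  have := Fintype.ofFinite ι
  suffices H : ∀ S : Finset ι, i ∉ S → ∃ b' : Basis ι R M, ∀ j ∈ S, φ (b' j) = 0 by
    obtain ⟨b', hb'⟩ := H (Finset.univ.erase i) (by simp)
    exact ⟨b', fun j hj => hb' j (by simp [hj])⟩
  intro S
  induction S using Finset.induction_on with
  | empty => exact fun _ => ⟨b, by simp⟩
  | insert j S hj ih =>
    intro hi
    rw [Finset.mem_insert, not_or] at hi
    obtain ⟨b', hb'⟩ := ih hi.2
    obtain ⟨d, a₁, a₂, u, w, h1, h2, huw⟩ := hH (φ (b' i)) (φ (b' j))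
    refine ⟨b'.map (b'.planeEquiv hi.1 u (-a₂) w a₁ (by linear_combination huw)), fun k hk => ?_⟩
    rw [Finset.mem_insert] at hk
    rcases hk with rfl | hk
    · simp [Basis.planeEquiv, hi.1, h1, h2]
      ring
    · have hki : k ≠ i := fun h => hi.2 (h ▸ hk)
      have hkj : k ≠ j := fun h => hj (h ▸ hk)
      simp [Basis.planeEquiv, hki.symm, hkj.symm, hb' k hk]

lemma HasHermiteFactorization.exists_smul_unimodular {R ι : Type*} [CommRing R]
    (hH : HasHermiteFactorization R) [Fintype ι] (i : ι) (v : ι → R) :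
    ∃ (d : R) (v' r : ι → R), v = d • v' ∧ v' ⬝ᵥ r = 1 := by
  classical
  obtain ⟨b, hb⟩ := hH.exists_basis (Pi.basisFun R ι) (dotProductBilin R R v) i
  have key (x : ι → R) : v ⬝ᵥ x = (v ⬝ᵥ b i) * b.coord i x := by
    conv_lhs => rw [← b.sum_repr x]
    rw [dotProduct_sum, Finset.sum_eq_single i]
    · simp [mul_comm]
    · intro j _ hj
      have := hb j hj
      simp_all
    · simp
  refine ⟨v ⬝ᵥ b i, fun k => b.coord i (Pi.single k 1), b i, ?_, ?_⟩
  · ext k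
    simpa using key (Pi.single k 1)
  · have : b.coord i (b i) = 1 := by simp
    have hs (k : ι) : (fun j => if k = j then (1 : R) else 0) = Pi.single k 1 := by
      ext j
      simp [Pi.single_apply, eq_comm]
    refine Eq.trans ?_ this
    conv_rhs => rw [LinearMap.pi_apply_eq_sum_univ (b.coord i) (b i)]
    simp [dotProduct, mul_comm, hs]

lemma HasHermiteFactorization.exists_basis_ker {R M : Type*} [CommRing R] [AddCommGroup M]
    [Module R M] (hH : HasHermiteFactorization R) {n : ℕ} (b : Basis (Fin (n + 1)) R M)
    (φ : M →ₗ[R] R) {y : M} (hy : φ y = 1) : Nonempty (Basis (Fin n) R (LinearMap.ker φ)) := by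
  obtain ⟨b', hb'⟩ := hH.exists_basis b φ 0
  have key (x : M) : φ x = b'.repr x 0 * φ (b' 0) := by
    conv_lhs => rw [← b'.sum_repr x]
    rw [map_sum, Fin.sum_univ_succ]
    simp [hb', Fin.succ_ne_zero]
  let v (j : Fin n) : LinearMap.ker φ := ⟨b' j.succ, hb' _ (Fin.succ_ne_zero j)⟩
  refine ⟨Basis.mk (v := v) ?_ ?_⟩
  · apply LinearIndependent.of_comp (LinearMap.ker φ).subtype
    exact b'.linearIndependent.comp _ (Fin.succ_injective n)
  · rintro ⟨x, hx⟩ -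
    have h0 : b'.repr x 0 = 0 := by
      have h1 := key x
      have h2 := key y
      rw [LinearMap.mem_ker] at hx
      linear_combination -b'.repr x 0 * hy + b'.repr x 0 * h2 - b'.repr y 0 * h1 +
        b'.repr y 0 * hx
    have : (⟨x, hx⟩ : LinearMap.ker φ) = ∑ j : Fin n, b'.repr x j.succ • v j := by
      apply Subtype.ext
      have := b'.sum_repr x
      rw [Fin.sum_univ_succ, h0, zero_smul, zero_add] at this
      simp [v, this]
    rw [this]
    exact Submodule.sum_mem _ fun j _ => Submodule.smul_mem _ _ (Submodule.subset_span ⟨j, rfl⟩)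

/-- A matrix whose entries are comaximal represents `1` as a bilinear form. -/
lemma LocallyStable.exists_dotProduct_mulVec_eq_one {R : Type*} [CommRing R]
    (h : LocallyStable R) (hH : HasHermiteFactorization R) {κ : Type*} [Fintype κ] (k : κ) (m : ℕ)
    (A : Matrix (Fin (m + 1)) κ R) (r : Fin (m + 1) × κ → R)
    (hr : (fun i => A i.1 i.2) ⬝ᵥ r = 1) : ∃ p q, p ⬝ᵥ A.mulVec q = 1 := by
  induction m with
  | zero =>
    refine ⟨1, fun k => r (0, k), ?_⟩
    simpa [dotProduct, Fintype.sum_prod_type, Matrix.mulVec] using hr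
  | succ m ih =>
    obtain ⟨d, g, s, hg, hgs⟩ := hH.exists_smul_unimodular ((0, k) : Fin (m + 1) × κ)
      (fun i => A i.1.succ i.2)
    obtain ⟨p, y, hpy⟩ := ih (Matrix.of fun i k => g (i, k)) s hgs
    set G : Matrix (Fin (m + 1)) κ R := Matrix.of fun i k => g (i, k)
    have hA (i : Fin (m + 1)) : A i.succ = d • G i := by
      ext k
      exact congrFun hg (i, k)
    set φ := Matrix.vecMul p G
    have hφ : φ ⬝ᵥ y = 1 := by rw [← hpy, Matrix.dotProduct_mulVec]
    obtain ⟨e, s', t, he, hst⟩ := hH.exists_smul_unimodular k (A 0 - (A 0 ⬝ᵥ y) • φ)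
    have hA0 : A 0 = e • s' + (A 0 ⬝ᵥ y) • φ := by rw [← he]; abel
    have ht : A 0 ⬝ᵥ t - (A 0 ⬝ᵥ y) * (φ ⬝ᵥ t) = e := by
      have := congrArg (· ⬝ᵥ t) he
      simpa [sub_dotProduct, smul_dotProduct, hst] using this
    have hspan : (1 : R) ∈ Ideal.span {d, A 0 ⬝ᵥ y, e} := by
      rw [← hr]
      refine Ideal.sum_mem _ fun i _ => Ideal.mul_mem_right _ _ ?_
      obtain ⟨i, k⟩ := i
      induction i using Fin.cases with
      | zero =>
        have := congrFun hA0 k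
        simp only [Pi.add_apply, Pi.smul_apply, smul_eq_mul] at this
        dsimp only
        rw [this]
        exact add_mem (Ideal.mul_mem_right _ _ (Ideal.subset_span (by simp)))
          (Ideal.mul_mem_right _ _ (Ideal.subset_span (by simp)))
      | succ i =>
        dsimp only
        rw [hA]
        exact Ideal.mul_mem_right _ _ (Ideal.subset_span (by simp))
    obtain ⟨x₁, x₂, x₃, hx⟩ := Submodule.mem_span_triple.1 hspan
    obtain ⟨p₀, p₁, q₀, q₁, hpq⟩ := h.exists_triangular_eq_one hH hx
    refine ⟨Fin.cons p₁ (p₀ • p), q₀ • y + q₁ • (t - (φ ⬝ᵥ t) • y), ?_⟩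
    have h1 (x : κ → R) : (Fin.cons p₁ (p₀ • p) : Fin (m + 2) → R) ⬝ᵥ A.mulVec x =
        p₁ * (A 0 ⬝ᵥ x) + p₀ * d * (φ ⬝ᵥ x) := by
      have : φ ⬝ᵥ x = ∑ i, p i * (G i ⬝ᵥ x) := by
        rw [← Matrix.dotProduct_mulVec]; rfl
      rw [this, dotProduct, Fin.sum_univ_succ, Finset.mul_sum]
      simp only [Fin.cons_zero, Fin.cons_succ]
      congr 1
      refine Finset.sum_congr rfl fun i _ => ?_
      change p₀ * p i * (A i.succ ⬝ᵥ x) = _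
      rw [hA, smul_dotProduct, smul_eq_mul]
      ring
    rw [h1]
    simp only [dotProduct_add, dotProduct_smul, dotProduct_sub, hφ, smul_eq_mul]
    linear_combination hpq + p₁ * q₁ * ht

lemma LocallyStable.exists_smul_apply_eq_one {R M N : Type*} [CommRing R] [AddCommGroup M]
    [Module R M] [AddCommGroup N] [Module R N] (h : LocallyStable R)
    (hH : HasHermiteFactorization R) {m n : ℕ} (b : Basis (Fin (n + 1)) R M)
    (c : Basis (Fin (m + 1)) R N) (f : M →ₗ[R] N) :
    ∃ (d : R) (f' : M →ₗ[R] N) (p : N →ₗ[R] R) (y : M), f = d • f' ∧ p (f' y) = 1 := by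
  obtain ⟨d, v, r, hv, hvr⟩ := hH.exists_smul_unimodular ((0, 0) : Fin (m + 1) × Fin (n + 1))
    (fun i => LinearMap.toMatrix b c f i.1 i.2)
  obtain ⟨p, q, hpq⟩ := h.exists_dotProduct_mulVec_eq_one hH 0 m (Matrix.of fun i j => v (i, j)) r
    hvr
  set A : Matrix (Fin (m + 1)) (Fin (n + 1)) R := Matrix.of fun i j => v (i, j)
  refine ⟨d, Matrix.toLin b c A, (dotProductBilin R R p).comp c.equivFun.toLinearMap,
    b.equivFun.symm q, ?_, ?_⟩
  · apply (LinearMap.toMatrix b c).injective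
    ext i j
    simpa [A] using congrFun hv (i, j)
  · have hq : ⇑(b.repr (b.equivFun.symm q)) = q := b.equivFun.apply_symm_apply q
    have : c.equivFun (Matrix.toLin b c A (b.equivFun.symm q)) = A.mulVec q := by
      have := LinearMap.toMatrix_mulVec_repr b c (Matrix.toLin b c A) (b.equivFun.symm q)
      rw [LinearMap.toMatrix_toLin, hq] at this
      exact this.symm
    rw [LinearMap.comp_apply, LinearEquiv.coe_coe, this]
    exact hpq

theorem LocallyStable.exists_bases_diagonal {R : Type*} [CommRing R] (h : LocallyStable R)
    (hH : HasHermiteFactorization R) {M N : Type*} [AddCommGroup M] [Module R M] [AddCommGroup N]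
    [Module R N] {m n : ℕ} (b : Basis (Fin n) R M) (c : Basis (Fin m) R N) (f : M →ₗ[R] N) :
    ∃ (b' : Basis (Fin n) R M) (c' : Basis (Fin m) R N) (d : ℕ → R), (∀ i, d i ∣ d (i + 1)) ∧
      ∀ j, f (b' j) = ∑ i : Fin m, (if (i : ℕ) = j then d j else 0) • c' i := by
  induction n generalizing M N m with
  | zero => exact ⟨b, c, 0, by simp, fun j => j.elim0⟩
  | succ n ih =>
    cases m with
    | zero => exact ⟨b, c, 0, by simp, fun j => c.ext_elem fun i => i.elim0⟩
    | succ m =>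
      obtain ⟨e, f', p, y, rfl, hy⟩ := h.exists_smul_apply_eq_one hH b c f
      obtain ⟨b₁⟩ := hH.exists_basis_ker b (p.comp f') (y := y) hy
      obtain ⟨c₁⟩ := hH.exists_basis_ker c p hy
      obtain ⟨b₂, c₂, d, hd, hf⟩ := ih b₁ c₁
        (f'.restrict (p := LinearMap.ker (p.comp f')) (q := LinearMap.ker p) (fun x hx => hx))
      refine ⟨Basis.mkFinCons y b₂ ?_ ?_, Basis.mkFinCons (f' y) c₂ ?_ ?_,
        fun i => e * Nat.casesOn i 1 d, ?_, ?_⟩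
      · intro a x hx hax
        have := congrArg (p.comp f') hax
        rw [map_add, LinearMap.mem_ker.1 hx] at this
        simpa [hy] using this
      · exact fun z => ⟨-p (f' z), by simp [hy]⟩
      · intro a x hx hax
        have := congrArg p hax
        rw [map_add, LinearMap.mem_ker.1 hx] at this
        simpa [hy] using this
      · exact fun z => ⟨-p z, by simp [hy]⟩
      · rintro (_ | i)
        · simp
        · exact mul_dvd_mul_left e (hd i)
      · intro j
        induction j using Fin.cases with
        | zero => simp
        | succ j =>
          have := congrArg (LinearMap.ker p).subtype (hf j)
          simp only [map_sum, map_smul, Submodule.subtype_apply] at this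
          change f' (b₂ j) = _ at this
          simp [Fin.sum_univ_succ, this, Finset.smul_sum, mul_smul]

lemma LocallyStable.elementaryDivisorRing {R : Type*} [CommRing R] (h : LocallyStable R)
    (hH : HasHermiteFactorization R) : ElementaryDivisorRing R := by
  intro m n A
  obtain ⟨b, c, d, hd, hf⟩ := h.exists_bases_diagonal hH (Pi.basisFun R (Fin n))
    (Pi.basisFun R (Fin m)) (Matrix.toLin' A)
  have key (i : Fin m) (j : Fin n) : (c.toMatrix (Pi.basisFun R (Fin m)) * A *
      (Pi.basisFun R (Fin n)).toMatrix b) i j = if (i : ℕ) = j then d j else 0 := by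
    have := basis_toMatrix_mul_linearMap_toMatrix_mul_basis_toMatrix b (Pi.basisFun R (Fin n))
      c (Pi.basisFun R (Fin m)) (Matrix.toLin' A)
    have hA : LinearMap.toMatrix (Pi.basisFun R (Fin n)) (Pi.basisFun R (Fin m))
        (Matrix.toLin' A) = A := LinearMap.toMatrix'_toLin' A
    rw [hA] at this
    rw [this, LinearMap.toMatrix_apply, hf, c.repr_sum_self]
  refine ⟨c.toMatrix (Pi.basisFun R (Fin m)), (Pi.basisFun R (Fin n)).toMatrix b, ?_, ?_, ?_, ?_⟩
  · have := c.invertibleToMatrix (Pi.basisFun R (Fin m))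
    exact isUnit_of_invertible _
  · have := (Pi.basisFun R (Fin n)).invertibleToMatrix b
    exact isUnit_of_invertible _
  · intro i j hij
    rw [key, if_neg hij]
  · intro i i' j j' hij hij' hii'
    rw [key, key, if_pos hij, if_pos hij', ← hij, ← hij', hii']
    exact hd i

lemma ElementaryDivisorRing.isBezout {R : Type*} [CommRing R] (h : ElementaryDivisorRing R) :
    IsBezout R := by
  rw [IsBezout.iff_span_pair_isPrincipal]
  intro a b
  obtain ⟨P, Q, hP, hQ, hdiag, -⟩ := h 1 2 !![a, b]
  obtain ⟨Q', hQ'⟩ := hQ.exists_right_inv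
  have hPdet := (Matrix.isUnit_iff_isUnit_det P).1 hP
  rw [Matrix.det_fin_one] at hPdet
  have h1 : a * Q 0 1 + b * Q 1 1 = 0 := by
    have := hdiag 0 1 (by simp)
    rw [Matrix.mul_assoc, Matrix.mul_apply, Fin.sum_univ_one, hPdet.mul_right_eq_zero] at this
    simpa [Matrix.mul_apply] using this
  have h2 (j : Fin 2) : (a * Q 0 0 + b * Q 1 0) * Q' 0 j = !![a, b] 0 j := by
    have : (!![a, b] * Q * Q') 0 j = !![a, b] 0 j := by
      rw [Matrix.mul_assoc, hQ', Matrix.mul_one]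
    rw [← this, Matrix.mul_apply, Fin.sum_univ_two]
    simp [Matrix.mul_apply, h1]
  refine ⟨a * Q 0 0 + b * Q 1 0, le_antisymm ?_ ?_⟩
  · rw [Ideal.span_le]
    rintro x (rfl | rfl)
    · exact Ideal.mem_span_singleton.2 ⟨_, (h2 0).symm⟩
    · exact Ideal.mem_span_singleton.2 ⟨_, (h2 1).symm⟩
  · rw [Submodule.span_singleton_le_iff_mem]
    exact Ideal.mem_span_pair.2 ⟨Q 0 0, Q 1 0, by ring⟩

theorem stmt8 (R : Type*) [CommRing R] (h : LocallyStable R) :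
    ElementaryDivisorRing R ↔ IsBezout R :=
  ⟨fun hR => hR.isBezout, fun hR => h.elementaryDivisorRing (h.hasHermiteFactorization hR)⟩
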